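/- The bitwise inner-product function IP : {0,1}^n × {0,1}^n → {0,1}, IP(x,y) = Σ_i x_i y_i (mod 2), can be computed in the garden-hose model with 4n + 1 pipes: GH(IP) ≤ 4n + 1. -/

import Mathlib

/-- A partial matching on the vertex type `V`, encoded by a partner function:
`m i = some j` means that there is an edge between `i` and `j`;
the graph `{ {i,j} | m i = some j }` then has maximum degree at most `1`
and no self-loops. -/
def IsPartialMatching {V : Type*} (m : V → Option V) : Prop :=
  ∀ i j, m i = some j → i ≠ j ∧ m j = some i

/-- The position of the water in a garden-hose game with `s` pipes:
`atAlice i` (resp. `atBob i`) means the water has just arrived at Alice's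
(resp. Bob's) end of pipe `i`; `exitA` / `exitB` mean the water has exited
on Alice's / Bob's side, i.e. the maximal path starting at the tap has ended
in `A∘` / in `B`. -/
inductive GHState (s : ℕ) where
  | atAlice : Fin s → GHState s
  | atBob : Fin s → GHState s
  | exitA : GHState s
  | exitB : GHState s
  deriving DecidableEq

/-- Vertex `k` of `A∘ = {0, 1, ..., s}` viewed as a pipe: vertex `0` is the water
tap (no pipe), and vertex `i + 1` is Alice's end of pipe `i`. -/
def toPipe {s : ℕ} (k : Fin (s + 1)) : Option (Fin s) :=
  if h : (k : ℕ) = 0 then none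
  else some ⟨(k : ℕ) - 1, by have := k.isLt; omega⟩

/-- One step of the water flow, given Alice's connections `a` on `A∘ = {0,...,s}`
and Bob's connections `b` on `B = {1,...,s}` (indexed by pipes `Fin s`). -/
def ghStep {s : ℕ} (a : Fin (s + 1) → Option (Fin (s + 1)))
    (b : Fin s → Option (Fin s)) : GHState s → GHState s
  | GHState.atAlice i =>
    match a i.succ with
    | none => GHState.exitA
    | some k =>
      match toPipe k with
      | none => GHState.exitA
      | some p => GHState.atBob p
  | GHState.atBob i =>
    match b i with
    | none => GHState.exitB
    | some j => GHState.atAlice j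
  | GHState.exitA => GHState.exitA
  | GHState.exitB => GHState.exitB

/-- The start of the water flow: the tap (vertex `0` of `A∘`) is connected by
Alice to at most one pipe. -/
def ghStart {s : ℕ} (a : Fin (s + 1) → Option (Fin (s + 1))) : GHState s :=
  match a 0 with
  | none => GHState.exitA
  | some k =>
    match toPipe k with
    | none => GHState.exitA
    | some p => GHState.atBob p

/-- The endpoint of the maximal path `π(x,y)` starting at the tap: since the graph
has maximum degree `2` and the path is simple, it is reached after at most
`2s + 2` steps. -/
def ghResult {s : ℕ} (a : Fin (s + 1) → Option (Fin (s + 1)))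
    (b : Fin s → Option (Fin s)) : GHState s :=
  (ghStep a b)^[2 * s + 2] (ghStart a)

/-- A garden-hose game of size `s` on inputs `{0,1}^n × {0,1}^n`: for every input
`x` Alice chooses a partial matching `EA x` on `A∘ = {0,1,…,s}` and for every
input `y` Bob chooses a partial matching `EB y` on `B = {1,…,s}`. -/
structure GHGame (n s : ℕ) where
  EA : (Fin n → Bool) → Fin (s + 1) → Option (Fin (s + 1))
  EB : (Fin n → Bool) → Fin s → Option (Fin s)
  matchA : ∀ x, IsPartialMatching (EA x)
  matchB : ∀ y, IsPartialMatching (EB y)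

/-- Where the water exits on input `(x, y)`. -/
def GHGame.run {n s : ℕ} (G : GHGame n s) (x y : Fin n → Bool) : GHState s :=
  ghResult (G.EA x) (G.EB y)

/-- The game `G` computes `f` if for all inputs the maximal path from the tap ends
in `A∘` whenever `f x y = 0` (water exits on Alice's side) and in `B` whenever
`f x y = 1` (water exits on Bob's side). -/
def GHGame.Computes {n s : ℕ} (G : GHGame n s)
    (f : (Fin n → Bool) → (Fin n → Bool) → Bool) : Prop :=
  ∀ x y, G.run x y = if f x y then GHState.exitB else GHState.exitA

/-- The garden-hose complexity of `f`: the minimal number of pipes of a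
garden-hose game computing `f`. -/
noncomputable def GH {n : ℕ} (f : (Fin n → Bool) → (Fin n → Bool) → Bool) : ℕ :=
  sInf {s : ℕ | ∃ G : GHGame n s, G.Computes f}

/-- The bitwise inner-product function: `IP x y = Σ_i x_i y_i (mod 2)`. -/
def IPfun (n : ℕ) (x y : Fin n → Bool) : Bool :=
  decide ((Finset.univ.filter fun i => x i = true ∧ y i = true).card % 2 = 1)

open Classical in
/-- The partner function of a relation. -/
noncomputable def relMatch {V : Type*} (R : V → V → Prop) (u : V) : Option V :=
  if h : ∃ v, R u v then some h.choose else none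

theorem relMatch_some {V : Type*} {R : V → V → Prop}
    (hf : ∀ u v w, R u v → R u w → v = w) {u v : V} (h : R u v) : relMatch R u = some v := by
  have h' : ∃ v, R u v := ⟨v, h⟩
  rw [relMatch, dif_pos h']
  exact congrArg some (hf _ _ _ h'.choose_spec h)

theorem relMatch_none {V : Type*} {R : V → V → Prop} {u : V} (h : ∀ v, ¬ R u v) :
    relMatch R u = none := by
  rw [relMatch, dif_neg]
  rintro ⟨v, hv⟩
  exact h v hv

theorem relMatch_isPartialMatching {V : Type*} {R : V → V → Prop}
    (hf : ∀ u v w, R u v → R u w → v = w) (hs : ∀ u v, R u v → R v u) (hi : ∀ u, ¬ R u u) :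
    IsPartialMatching (relMatch R) := by
  intro u v h
  have huv : R u v := by
    unfold relMatch at h
    split at h
    · rename_i h'
      have := h'.choose_spec
      rw [Option.some.inj h] at this
      exact this
    · cases h
  refine ⟨?_, relMatch_some hf (hs _ _ huv)⟩
  rintro rfl
  exact hi _ huv

/-- Active levels: level `0` is the tap, level `k + 1` is bit `k`, level `n + 1` is the end. -/
def Act (X : ℕ → Bool) (l : ℕ) : Prop := l = 0 ∨ X (l - 1) = true

/-- Consecutive active levels. -/
def Conn (X : ℕ → Bool) (i j : ℕ) : Prop :=
  i < j ∧ Act X i ∧ Act X j ∧ ∀ k, i < k → k < j → ¬ Act X k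

theorem Conn.right_unique {X : ℕ → Bool} {i j k : ℕ} (h : Conn X i j) (h' : Conn X i k) :
    j = k := by
  rcases lt_trichotomy j k with hh | hh | hh
  · exact absurd h.2.2.1 (h'.2.2.2 _ h.1 hh)
  · exact hh
  · exact absurd h'.2.2.1 (h.2.2.2 _ h'.1 hh)

theorem Conn.left_unique {X : ℕ → Bool} {i j k : ℕ} (h : Conn X i k) (h' : Conn X j k) :
    i = j := by
  rcases lt_trichotomy i j with hh | hh | hh
  · exact absurd h'.2.1 (h.2.2.2 _ hh h'.1)
  · exact hh
  · exact absurd h.2.1 (h'.2.2.2 _ hh h.1)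

/-- Alice's oriented edges: output with parity `c` of level `i`, to the input with parity `c`
of the next active level. -/
def RA0 (X : ℕ → Bool) (u v : ℕ) : Prop :=
  ∃ i j c, c ≤ 1 ∧ u + c = 4 * i ∧ v + c + 2 = 4 * j ∧ Conn X i j

/-- Alice's edges. -/
def RA (X : ℕ → Bool) (s : ℕ) (u v : Fin (s + 1)) : Prop := RA0 X u v ∨ RA0 X v u

/-- Bob's oriented edges: input with parity `c` of bit `q`, to output of parity `c + y q`. -/
def RB0 (Y : ℕ → Bool) (n : ℕ) (u v : ℕ) : Prop :=
  ∃ q c d, q < n ∧ c ≤ 1 ∧ d ≤ 1 ∧ d = (c + if Y q then 1 else 0) % 2 ∧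
    u + c = 4 * q + 1 ∧ v + d = 4 * q + 3

/-- Bob's edges. -/
def RB (Y : ℕ → Bool) (n s : ℕ) (u v : Fin s) : Prop := RB0 Y n u v ∨ RB0 Y n v u

theorem RA_functional (X : ℕ → Bool) (s : ℕ) : ∀ u v w, RA X s u v → RA X s u w → v = w := by
  rintro u v w (⟨i, j, c, hc, h1, h2, h⟩ | ⟨i, j, c, hc, h1, h2, h⟩)
    (⟨i', j', c', hc', h1', h2', h'⟩ | ⟨i', j', c', hc', h1', h2', h'⟩)
  · obtain rfl : i = i' := by omega
    have := h.right_unique h'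
    omega
  · omega
  · omega
  · obtain rfl : j = j' := by omega
    have := h.left_unique h'
    omega

theorem RA_irrefl (X : ℕ → Bool) (s : ℕ) : ∀ u, ¬ RA X s u u := by
  rintro u (⟨i, j, c, hc, h1, h2, h⟩ | ⟨i, j, c, hc, h1, h2, h⟩) <;> omega

theorem RB_functional (Y : ℕ → Bool) (n s : ℕ) :
    ∀ u v w, RB Y n s u v → RB Y n s u w → v = w := by
  rintro u v w (⟨q, c, d, hq, hc, hd, h1, h2, h3⟩ | ⟨q, c, d, hq, hc, hd, h1, h2, h3⟩)
    (⟨q', c', d', hq', hc', hd', h1', h2', h3'⟩ | ⟨q', c', d', hq', hc', hd', h1', h2', h3'⟩)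
  all_goals
    by_cases hqq : q = q'
    · subst hqq
      split_ifs at h1 h1' <;> omega
    · omega

theorem RB_irrefl (Y : ℕ → Bool) (n s : ℕ) : ∀ u, ¬ RB Y n s u u := by
  rintro u (⟨q, c, d, hq, hc, hd, h1, h2, h3⟩ | ⟨q, c, d, hq, hc, hd, h1, h2, h3⟩) <;> omega

/-- Where the water goes when leaving along Alice's vertex `v`. -/
def leaveA {s : ℕ} (a : Fin (s + 1) → Option (Fin (s + 1))) (v : Fin (s + 1)) : GHState s :=
  match a v with
  | none => GHState.exitA
  | some k =>
    match toPipe k with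
    | none => GHState.exitA
    | some p => GHState.atBob p

/-- Extension of a bit string to the naturals. -/
def extBits {n : ℕ} (d : Bool) (x : Fin n → Bool) (k : ℕ) : Bool :=
  if h : k < n then x ⟨k, h⟩ else d

/-- The summand of the inner product. -/
def ipTerm (X Y : ℕ → Bool) (k : ℕ) : ℕ := if X k = true ∧ Y k = true then 1 else 0

theorem exists_conn {n : ℕ} {X : ℕ → Bool} (hX : X n = true) {i : ℕ} (hi : i ≤ n)
    (ha : Act X i) : ∃ j, Conn X i j ∧ j ≤ n + 1 := by
  classical
  have hex : ∃ j, i < j ∧ Act X j := ⟨n + 1, by omega, Or.inr (by simpa using hX)⟩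
  refine ⟨Nat.find hex, ⟨(Nat.find_spec hex).1, ha, (Nat.find_spec hex).2, ?_⟩, ?_⟩
  · intro k hk hk' hkk
    exact Nat.find_min hex hk' ⟨hk, hkk⟩
  · exact Nat.find_min' hex ⟨by omega, Or.inr (by simpa using hX)⟩

theorem sum_conn_zero {X Y : ℕ → Bool} {i j : ℕ} (h : Conn X i j) :
    ∑ k ∈ Finset.Ico i (j - 1), ipTerm X Y k = 0 := by
  apply Finset.sum_eq_zero
  intro k hk
  rw [Finset.mem_Ico] at hk
  have := h.2.2.2 (k + 1) (by omega) (by omega)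
  unfold ipTerm
  rw [if_neg]
  rintro ⟨h1, -⟩
  exact this (Or.inr (by simpa using h1))

theorem sum_conn {n : ℕ} {X Y : ℕ → Bool} {i j : ℕ} (h : Conn X i j) (hj : j ≤ n) :
    ∑ k ∈ Finset.Ico i n, ipTerm X Y k =
      (if Y (j - 1) then 1 else 0) + ∑ k ∈ Finset.Ico j n, ipTerm X Y k := by
  have hij := h.1
  rw [← Finset.sum_Ico_consecutive _ (show i ≤ j - 1 by omega) (show j - 1 ≤ n by omega),
    sum_conn_zero h, zero_add, Finset.sum_eq_sum_Ico_succ_bot (by omega),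
    show j - 1 + 1 = j by omega]
  congr 1
  have : X (j - 1) = true := by
    rcases h.2.2.1 with h | h
    · omega
    · exact h
  simp [ipTerm, this]

theorem flow {n : ℕ} {X Y : ℕ → Bool} (hX : X n = true) :
    ∀ m i, n - i = m → i ≤ n → Act X i → ∀ (c : ℕ) (v : Fin (4 * n + 1 + 1)), c ≤ 1 →
      (v : ℕ) + c = 4 * i →
      ∃ t ≤ 2 * m + 1,
        (ghStep (relMatch (RA X (4 * n + 1))) (relMatch (RB Y n (4 * n + 1))))^[t]
          (leaveA (relMatch (RA X (4 * n + 1))) v) =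
        if (c + ∑ k ∈ Finset.Ico i n, ipTerm X Y k) % 2 = 1 then GHState.exitB
          else GHState.exitA := by
  intro m
  induction m using Nat.strong_induction_on with
  | _ m ih =>
  intro i hm hi ha c v hc hv
  obtain ⟨j, hconn, hj⟩ := exists_conn hX hi ha
  have hij := hconn.1
  -- the edge Alice uses, when it exists
  have key : ∀ p : Fin (4 * n + 1), (p : ℕ) + c + 3 = 4 * j →
      leaveA (relMatch (RA X (4 * n + 1))) v = GHState.atBob p := by
    intro p hp
    have : relMatch (RA X (4 * n + 1)) v = some p.succ := by
      apply relMatch_some (RA_functional _ _)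
      exact Or.inl ⟨i, j, c, hc, hv, by rw [Fin.val_succ]; omega, hconn⟩
    simp [leaveA, this, toPipe]
  by_cases hjn : j = n + 1
  · subst hjn
    have h0 := sum_conn_zero (Y := Y) hconn
    rw [Nat.add_sub_cancel] at h0
    rw [h0]
    obtain rfl | rfl : c = 0 ∨ c = 1 := by omega
    · refine ⟨0, by omega, ?_⟩
      have : relMatch (RA X (4 * n + 1)) v = none := by
        apply relMatch_none
        rintro w (⟨i', j', c', hc', h1', h2', h'⟩ | ⟨i', j', c', hc', h1', h2', h'⟩)
        · obtain rfl : i = i' := by omega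
          have := hconn.right_unique h'
          have := w.isLt
          omega
        · omega
      simp [leaveA, this]
    · refine ⟨1, by omega, ?_⟩
      rw [key ⟨4 * n, by omega⟩ (by simp; omega)]
      have : relMatch (RB Y n (4 * n + 1)) ⟨4 * n, by omega⟩ = none := by
        apply relMatch_none
        rintro w (⟨q, c, d, hq, hc, hd, h1, h2, h3⟩ | ⟨q, c, d, hq, hc, hd, h1, h2, h3⟩) <;>
          simp only at h2 h3 <;> omega
      simp [ghStep, this]
  · have hjn' : j ≤ n := by omega
    obtain ⟨d, hd⟩ : ∃ d, d = (c + if Y (j - 1) then 1 else 0) % 2 := ⟨_, rfl⟩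
    have hd1 : d ≤ 1 := by omega
    obtain ⟨t, ht, hrun⟩ := ih (n - j) (by omega) j rfl hjn' hconn.2.2.1 d
      (⟨4 * j - d - 1, by omega⟩ : Fin (4 * n + 1)).succ hd1 (by simp; omega)
    refine ⟨t + 2, by omega, ?_⟩
    rw [key ⟨4 * j - 3 - c, by omega⟩ (by simp; omega)]
    have hb : relMatch (RB Y n (4 * n + 1)) ⟨4 * j - 3 - c, by omega⟩ =
        some ⟨4 * j - d - 1, by omega⟩ := by
      apply relMatch_some (RB_functional _ _ _)
      exact Or.inl ⟨j - 1, c, d, by omega, hc, hd1, hd, by simp only; omega, by simp only; omega⟩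
    have e1 : ghStep (relMatch (RA X (4 * n + 1))) (relMatch (RB Y n (4 * n + 1)))
        (GHState.atBob ⟨4 * j - 3 - c, by omega⟩) =
        GHState.atAlice ⟨4 * j - d - 1, by omega⟩ := by
      simp only [ghStep, hb]
    rw [Function.iterate_add_apply]
    have e2 : (ghStep (relMatch (RA X (4 * n + 1))) (relMatch (RB Y n (4 * n + 1))))^[2]
        (GHState.atBob ⟨4 * j - 3 - c, by omega⟩) =
        leaveA (relMatch (RA X (4 * n + 1)))
          (⟨4 * j - d - 1, by omega⟩ : Fin (4 * n + 1)).succ := by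
      rw [Function.iterate_succ_apply, e1]
      rfl
    rw [e2, hrun, sum_conn hconn hjn']
    congr 2
    omega

theorem IPfun_eq {n : ℕ} (x y : Fin n → Bool) :
    IPfun n x y = decide ((∑ k ∈ Finset.Ico 0 n,
      ipTerm (extBits true x) (extBits false y) k) % 2 = 1) := by
  unfold IPfun
  rw [Finset.card_filter, ← Finset.range_eq_Ico, Finset.sum_range]
  simp [ipTerm, extBits]

/-- The garden-hose game for the inner product. -/
noncomputable def ipGame (n : ℕ) : GHGame n (4 * n + 1) where
  EA x := relMatch (RA (extBits true x) (4 * n + 1))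
  EB y := relMatch (RB (extBits false y) n (4 * n + 1))
  matchA x := relMatch_isPartialMatching (RA_functional _ _) (fun _ _ h => h.symm) (RA_irrefl _ _)
  matchB y := relMatch_isPartialMatching (RB_functional _ _ _) (fun _ _ h => h.symm)
    (RB_irrefl _ _ _)

theorem ipGame_computes (n : ℕ) : (ipGame n).Computes (IPfun n) := by
  intro x y
  obtain ⟨t, ht, hrun⟩ := flow (n := n) (X := extBits true x) (Y := extBits false y)
    (by simp [extBits]) n 0 (by omega) (by omega) (Or.inl rfl) 0 0 (by omega) (by simp)
  rw [zero_add] at hrun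
  have hs : (ipGame n).run x y =
      (ghStep (relMatch (RA (extBits true x) (4 * n + 1)))
        (relMatch (RB (extBits false y) n (4 * n + 1))))^[(2 * (4 * n + 1) + 2 - t) + t]
          (leaveA (relMatch (RA (extBits true x) (4 * n + 1))) 0) := by
    rw [Nat.sub_add_cancel (by omega)]
    rfl
  rw [hs, Function.iterate_add_apply, hrun, IPfun_eq]
  simp only [decide_eq_true_eq]
  split_ifs
  · exact Function.iterate_fixed rfl _
  · exact Function.iterate_fixed rfl _

/-- The bitwise inner-product function can be computed in the garden-hose model
with `4n + 1` pipes: `GH(IP) ≤ 4n + 1`. -/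
theorem gh_ip_upper_bound (n : ℕ) :
    (∃ G : GHGame n (4 * n + 1), G.Computes (IPfun n)) ∧
      GH (IPfun n) ≤ 4 * n + 1 := by
  exact ⟨⟨ipGame n, ipGame_computes n⟩, Nat.sInf_le ⟨ipGame n, ipGame_computes n⟩⟩
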